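/- Let m ≥ 2 and let A and D be the adjacency and degree matrices of the rose graph R_m^4 on 3m + 1 vertices, and define the polynomial M_m(κ) = det((κ² − 1)·I + D − κ·A). Then κ₁ = (2m − 1)^{1/4} is the largest real root of M_m: one has M_m((2m − 1)^{1/4}) = 0, and every real number κ with M_m(κ) = 0 satisfies κ ≤ (2m − 1)^{1/4}. In particular, the leading eigenvalue of the non-backtracking matrix of R_m^4 is (2m − 1)^{1/4}. -/

import Mathlib

open Finset
/-- Adjacency matrix of the rose graph `R_m^4` on `3m+1` vertices: vertex `0` is the hub;
for each petal `p`, vertices `3p+1`, `3p+2` are internal and `3p+3` is peripheral, with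
edges `{0,3p+1}`, `{0,3p+2}`, `{3p+1,3p+3}`, `{3p+2,3p+3}`. -/
noncomputable def roseA (m : ℕ) : Matrix (Fin (3 * m + 1)) (Fin (3 * m + 1)) ℝ :=
  fun i j =>
    if ((i : ℕ) = 0 ∧ (j : ℕ) % 3 ≠ 0) ∨ ((j : ℕ) = 0 ∧ (i : ℕ) % 3 ≠ 0)
        ∨ ((i : ℕ) % 3 = 1 ∧ (j : ℕ) = (i : ℕ) + 2)
        ∨ ((i : ℕ) % 3 = 2 ∧ (j : ℕ) = (i : ℕ) + 1)
        ∨ ((j : ℕ) % 3 = 1 ∧ (i : ℕ) = (j : ℕ) + 2)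
        ∨ ((j : ℕ) % 3 = 2 ∧ (i : ℕ) = (j : ℕ) + 1)
    then 1 else 0

open Matrix

lemma roseA_mulVec_hub (m : ℕ) (v : Fin (3 * m + 1) → ℝ) :
    (roseA m *ᵥ v) 0 = ∑ j : Fin (3 * m + 1), if (j : ℕ) % 3 ≠ 0 then v j else 0 := by
  simp only [Matrix.mulVec, dotProduct]
  refine Finset.sum_congr rfl fun j _ => ?_
  have h : roseA m 0 j = if (j : ℕ) % 3 ≠ 0 then 1 else 0 := by
    unfold roseA
    refine if_congr ?_ rfl rfl
    rw [Fin.val_zero]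
    omega
  simp [h]

lemma roseA_mulVec_of_forall_iff (m : ℕ) (v : Fin (3 * m + 1) → ℝ) (i a b : Fin (3 * m + 1))
    (hab : a ≠ b)
    (h : ∀ j : Fin (3 * m + 1),
      (((i : ℕ) = 0 ∧ (j : ℕ) % 3 ≠ 0) ∨ ((j : ℕ) = 0 ∧ (i : ℕ) % 3 ≠ 0)
        ∨ ((i : ℕ) % 3 = 1 ∧ (j : ℕ) = (i : ℕ) + 2)
        ∨ ((i : ℕ) % 3 = 2 ∧ (j : ℕ) = (i : ℕ) + 1)
        ∨ ((j : ℕ) % 3 = 1 ∧ (i : ℕ) = (j : ℕ) + 2)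
        ∨ ((j : ℕ) % 3 = 2 ∧ (i : ℕ) = (j : ℕ) + 1)) ↔ (j : ℕ) = a ∨ (j : ℕ) = b) :
    (roseA m *ᵥ v) i = v a + v b := by
  have hrow : ∀ j, roseA m i j = (if j = a then 1 else 0) + (if j = b then 1 else 0) := by
    intro j
    unfold roseA
    rw [if_congr (h j) rfl rfl]
    simp only [← Fin.ext_iff]
    by_cases ha : j = a
    · subst ha
      simp [hab]
    · simp [ha]
  simp [Matrix.mulVec, dotProduct, hrow, add_mul, Finset.sum_add_distrib]

lemma roseA_mulVec_first (m : ℕ) (v : Fin (3 * m + 1) → ℝ) (i k : Fin (3 * m + 1))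
    (hi : (i : ℕ) % 3 = 1) (hk : (k : ℕ) = i + 2) : (roseA m *ᵥ v) i = v 0 + v k := by
  refine roseA_mulVec_of_forall_iff m v i 0 k ?_ fun j => ?_
  · rw [Ne, Fin.ext_iff, Fin.val_zero]
    omega
  · rw [Fin.val_zero]
    omega

lemma roseA_mulVec_second (m : ℕ) (v : Fin (3 * m + 1) → ℝ) (i k : Fin (3 * m + 1))
    (hi : (i : ℕ) % 3 = 2) (hk : (k : ℕ) = i + 1) : (roseA m *ᵥ v) i = v 0 + v k := by
  refine roseA_mulVec_of_forall_iff m v i 0 k ?_ fun j => ?_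
  · rw [Ne, Fin.ext_iff, Fin.val_zero]
    omega
  · rw [Fin.val_zero]
    omega

lemma roseA_mulVec_peripheral (m : ℕ) (v : Fin (3 * m + 1) → ℝ) (i a b : Fin (3 * m + 1))
    (hi : (i : ℕ) % 3 = 0) (ha : (i : ℕ) = a + 2) (hb : (i : ℕ) = b + 1) :
    (roseA m *ᵥ v) i = v a + v b := by
  refine roseA_mulVec_of_forall_iff m v i a b ?_ fun j => ?_
  · rw [Ne, Fin.ext_iff]
    omega
  · omega

lemma sum_ite_mod_three (m : ℕ) (c : ℝ) :
    (∑ j : Fin (3 * m + 1), if (j : ℕ) % 3 ≠ 0 then c else 0) = 2 * m * c := by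
  rw [Fin.sum_univ_eq_sum_range (fun j => if j % 3 ≠ 0 then c else 0)]
  induction m with
  | zero => simp
  | succ m ih =>
    rw [show 3 * (m + 1) + 1 = 3 * m + 1 + 1 + 1 + 1 by ring, Finset.sum_range_succ,
      Finset.sum_range_succ, Finset.sum_range_succ, ih, if_pos (by omega), if_pos (by omega),
      if_neg (by omega)]
    push_cast
    ring

/-- The matrix `(κ² - 1)I + D - κA` of the rose graph `R_m^4`. -/
noncomputable abbrev roseIhara (m : ℕ) (κ : ℝ) : Matrix (Fin (3 * m + 1)) (Fin (3 * m + 1)) ℝ :=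
  (κ ^ 2 - 1) • (1 : Matrix (Fin (3 * m + 1)) (Fin (3 * m + 1)) ℝ)
    + Matrix.diagonal (fun i => ∑ j, roseA m i j) - κ • roseA m

lemma roseIhara_mulVec (m : ℕ) (κ : ℝ) (v : Fin (3 * m + 1) → ℝ) (i : Fin (3 * m + 1)) :
    (roseIhara m κ *ᵥ v) i =
      (κ ^ 2 - 1 + (roseA m *ᵥ fun _ => 1) i) * v i - κ * (roseA m *ᵥ v) i := by
  simp [Matrix.sub_mulVec, Matrix.add_mulVec, Matrix.smul_mulVec, Matrix.mulVec_diagonal]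
  simp [Matrix.mulVec, dotProduct, add_mul]

lemma roseIhara_mulVec_hub (m : ℕ) (κ : ℝ) (v : Fin (3 * m + 1) → ℝ) (c : ℝ)
    (hv : ∀ j : Fin (3 * m + 1), (j : ℕ) % 3 ≠ 0 → v j = c) :
    (roseIhara m κ *ᵥ v) 0 = (κ ^ 2 - 1 + 2 * m) * v 0 - κ * (2 * m * c) := by
  have h : (∑ j : Fin (3 * m + 1), if (j : ℕ) % 3 ≠ 0 then v j else 0) = 2 * m * c := by
    rw [← sum_ite_mod_three]
    refine Finset.sum_congr rfl fun j _ => ?_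
    split_ifs with hj
    · exact hv j hj
    · rfl
  rw [roseIhara_mulVec, roseA_mulVec_hub, roseA_mulVec_hub, h, sum_ite_mod_three, mul_one]

lemma roseIhara_mulVec_first (m : ℕ) (κ : ℝ) (v : Fin (3 * m + 1) → ℝ) (i k : Fin (3 * m + 1))
    (hi : (i : ℕ) % 3 = 1) (hk : (k : ℕ) = i + 2) :
    (roseIhara m κ *ᵥ v) i = (κ ^ 2 + 1) * v i - κ * (v 0 + v k) := by
  rw [roseIhara_mulVec, roseA_mulVec_first m _ i k hi hk, roseA_mulVec_first m _ i k hi hk]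
  ring

lemma roseIhara_mulVec_second (m : ℕ) (κ : ℝ) (v : Fin (3 * m + 1) → ℝ) (i k : Fin (3 * m + 1))
    (hi : (i : ℕ) % 3 = 2) (hk : (k : ℕ) = i + 1) :
    (roseIhara m κ *ᵥ v) i = (κ ^ 2 + 1) * v i - κ * (v 0 + v k) := by
  rw [roseIhara_mulVec, roseA_mulVec_second m _ i k hi hk, roseA_mulVec_second m _ i k hi hk]
  ring

lemma roseIhara_mulVec_peripheral (m : ℕ) (κ : ℝ) (v : Fin (3 * m + 1) → ℝ)
    (i a b : Fin (3 * m + 1)) (hi : (i : ℕ) % 3 = 0) (ha : (i : ℕ) = a + 2)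
    (hb : (i : ℕ) = b + 1) :
    (roseIhara m κ *ᵥ v) i = (κ ^ 2 + 1) * v i - κ * (v a + v b) := by
  rw [roseIhara_mulVec, roseA_mulVec_peripheral m _ i a b hi ha hb,
    roseA_mulVec_peripheral m _ i a b hi ha hb]
  ring

/-- Every non-hub vertex lies in a petal, whose two internal vertices and peripheral vertex are
consecutive. -/
lemma exists_petal (m : ℕ) (i : Fin (3 * m + 1)) (hi : i ≠ 0) :
    ∃ a b c : Fin (3 * m + 1), (a : ℕ) % 3 = 1 ∧ (b : ℕ) = a + 1 ∧ (c : ℕ) = a + 2 ∧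
      (i = a ∨ i = b ∨ i = c) := by
  have h0 : (i : ℕ) ≠ 0 := fun h => hi (Fin.ext h)
  have hlt := i.isLt
  refine ⟨⟨3 * ((i - 1) / 3) + 1, by omega⟩, ⟨3 * ((i - 1) / 3) + 2, by omega⟩,
    ⟨3 * ((i - 1) / 3) + 3, by omega⟩, ?_, ?_, ?_, ?_⟩ <;> simp only [Fin.ext_iff] <;> omega

lemma petal_of_roseIhara_mulVec_eq_zero {m : ℕ} {κ : ℝ} {v : Fin (3 * m + 1) → ℝ}
    (hv : roseIhara m κ *ᵥ v = 0) {a b c : Fin (3 * m + 1)} (ha : (a : ℕ) % 3 = 1)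
    (hb : (b : ℕ) = a + 1) (hc : (c : ℕ) = a + 2) :
    (κ ^ 4 + 1) * v a = κ * (κ ^ 2 + 1) * v 0 ∧ (κ ^ 4 + 1) * v b = κ * (κ ^ 2 + 1) * v 0 ∧
      (κ ^ 4 + 1) * v c = 2 * κ ^ 2 * v 0 := by
  have h1 := roseIhara_mulVec_first m κ v a c ha hc
  have h2 := roseIhara_mulVec_second m κ v b c (by omega) (by omega)
  have h3 := roseIhara_mulVec_peripheral m κ v c a b (by omega) hc (by omega)
  rw [hv, Pi.zero_apply] at h1 h2 h3
  have hpos : κ ^ 2 + 1 ≠ 0 := by positivity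
  have h4 : (κ ^ 4 + 1) * v c = 2 * κ ^ 2 * v 0 := by
    linear_combination -(κ ^ 2 + 1) * h3 - κ * h1 - κ * h2
  refine ⟨mul_left_cancel₀ hpos ?_, mul_left_cancel₀ hpos ?_, h4⟩
  · linear_combination -(κ ^ 4 + 1) * h1 + κ * h4
  · linear_combination -(κ ^ 4 + 1) * h2 + κ * h4

/-- The determinant of `(κ² - 1)I + D - κA` vanishes only at `κ = ±1` and `κ⁴ = 2m - 1`. -/
lemma eq_zero_of_det_roseIhara_eq_zero {m : ℕ} {κ : ℝ} (h : (roseIhara m κ).det = 0) :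
    (κ ^ 2 - 1) * (κ ^ 4 - (2 * m - 1)) = 0 := by
  obtain ⟨v, hv0, hv⟩ := Matrix.exists_mulVec_eq_zero_iff.mpr h
  have hpos : κ ^ 4 + 1 ≠ 0 := by positivity
  have hhub : v 0 ≠ 0 := by
    intro h0
    refine hv0 (funext fun i => ?_)
    by_cases hi : i = 0
    · rw [hi, h0, Pi.zero_apply]
    obtain ⟨a, b, c, ha, hb, hc, hi⟩ := exists_petal m i hi
    obtain ⟨h1, h2, h3⟩ := petal_of_roseIhara_mulVec_eq_zero hv ha hb hc
    simp only [h0, mul_zero, mul_eq_zero, hpos, false_or] at h1 h2 h3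
    rcases hi with rfl | rfl | rfl <;> assumption
  have hint : ∀ j : Fin (3 * m + 1), (j : ℕ) % 3 ≠ 0 →
      v j = κ * (κ ^ 2 + 1) * v 0 / (κ ^ 4 + 1) := by
    intro j hj
    obtain ⟨a, b, c, ha, hb, hc, hi⟩ := exists_petal m j (by rintro rfl; simp at hj)
    obtain ⟨h1, h2, -⟩ := petal_of_roseIhara_mulVec_eq_zero hv ha hb hc
    rw [eq_div_iff hpos, mul_comm]
    rcases hi with rfl | rfl | rfl
    · exact h1
    · exact h2
    · omega
  have hrow := roseIhara_mulVec_hub m κ v _ hint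
  rw [hv, Pi.zero_apply] at hrow
  field_simp at hrow
  refine mul_left_cancel₀ hhub ?_
  linear_combination -hrow

lemma det_roseIhara_eq_zero {m : ℕ} {κ : ℝ} (h : κ ^ 4 = 2 * m - 1) :
    (roseIhara m κ).det = 0 := by
  have hpos : κ ^ 4 + 1 ≠ 0 := by positivity
  let v : Fin (3 * m + 1) → ℝ := fun i =>
    if i = 0 then κ ^ 4 + 1 else if (i : ℕ) % 3 = 0 then 2 * κ ^ 2 else κ * (κ ^ 2 + 1)
  have hv0 : v 0 = κ ^ 4 + 1 := if_pos rfl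
  have hv1 : ∀ j : Fin (3 * m + 1), (j : ℕ) % 3 ≠ 0 → v j = κ * (κ ^ 2 + 1) := fun j hj =>
    (if_neg (by rintro rfl; simp at hj)).trans (if_neg hj)
  refine Matrix.exists_mulVec_eq_zero_iff.mp
    ⟨v, fun hv => hpos (by rw [← hv0, hv, Pi.zero_apply]), funext fun i => ?_⟩
  rw [Pi.zero_apply]
  by_cases hi : i = 0
  · rw [hi, roseIhara_mulVec_hub m κ v _ hv1, hv0]
    linear_combination (κ ^ 2 - 1) * h
  obtain ⟨a, b, c, ha, hb, hc, hi⟩ := exists_petal m i hi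
  have hva := hv1 a (by omega)
  have hvb := hv1 b (by omega)
  have hvc : v c = 2 * κ ^ 2 :=
    (if_neg (by rw [Fin.ext_iff, Fin.val_zero]; omega)).trans (if_pos (by omega))
  rcases hi with rfl | rfl | rfl
  · rw [roseIhara_mulVec_first m κ v i c ha hc, hva, hv0, hvc]
    ring
  · rw [roseIhara_mulVec_second m κ v i c (by omega) (by omega), hvb, hv0, hvc]
    ring
  · rw [roseIhara_mulVec_peripheral m κ v i a b (by omega) hc (by omega), hva, hvb, hvc]
    ring

/-- `κ₁ = (2m-1)^{1/4}` is the largest real root of the Ihara polynomial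
`M_m(κ) = det((κ²-1)I + D - κA)` of the rose graph `R_m^4`; hence it is the leading
eigenvalue of the non-backtracking matrix of `R_m^4`. -/
theorem rose_nb_leading_eigenvalue (m : ℕ) (hm : 2 ≤ m)
    (Mm : ℝ → ℝ)
    (hMm : ∀ κ : ℝ, Mm κ =
      ((κ ^ 2 - 1) • (1 : Matrix (Fin (3 * m + 1)) (Fin (3 * m + 1)) ℝ)
        + Matrix.diagonal (fun i => ∑ j, roseA m i j) - κ • roseA m).det) :
    Mm ((2 * (m : ℝ) - 1) ^ ((1 : ℝ) / 4)) = 0 ∧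
      ∀ κ : ℝ, Mm κ = 0 → κ ≤ (2 * (m : ℝ) - 1) ^ ((1 : ℝ) / 4) := by
  have hm' : (2 : ℝ) ≤ m := by exact_mod_cast hm
  have hnn : 0 ≤ (2 * (m : ℝ) - 1) ^ ((1 : ℝ) / 4) := Real.rpow_nonneg (by linarith) _
  have hpow : ((2 * (m : ℝ) - 1) ^ ((1 : ℝ) / 4)) ^ 4 = 2 * m - 1 := by
    rw [← Real.rpow_natCast, ← Real.rpow_mul (by linarith)]
    norm_num
  refine ⟨(hMm _).trans (det_roseIhara_eq_zero hpow), fun κ hκ => ?_⟩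
  refine le_of_pow_le_pow_left₀ four_ne_zero hnn ?_
  rw [hpow]
  rcases mul_eq_zero.mp (eq_zero_of_det_roseIhara_eq_zero ((hMm κ).symm.trans hκ)) with h | h
  · have h2 : κ ^ 2 = 1 := by linarith
    have h4 : κ ^ 4 = 1 := by rw [show κ ^ 4 = (κ ^ 2) ^ 2 by ring, h2, one_pow]
    linarith
  · linarith
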